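/- If X is a bent sequence for a Hadamard matrix H, then there exists a Hadamard matrix H' = S·H, with S a ±1 diagonal matrix (so H' is equivalent to H), such that X is a self-dual bent sequence for H'. -/

import Mathlib

def IsHadamard {v : ℕ} (H : Matrix (Fin v) (Fin v) ℝ) : Prop :=
  (∀ i j, H i j = 1 ∨ H i j = -1) ∧ H * H.transpose = (v : ℝ) • 1

def IsSignVector {v : ℕ} (X : Fin v → ℝ) : Prop := ∀ i, X i = 1 ∨ X i = -1

theorem bent_selfdual_for_equivalent {v : ℕ}
    (H : Matrix (Fin v) (Fin v) ℝ) (hH : IsHadamard H)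
    (X : Fin v → ℝ) (hX : IsSignVector X)
    (hbent : IsSignVector ((Real.sqrt v)⁻¹ • H.mulVec X)) :
    ∃ ε : Fin v → ℝ, (∀ i, ε i = 1 ∨ ε i = -1) ∧
      IsHadamard (Matrix.diagonal ε * H) ∧
      (Real.sqrt v)⁻¹ • (Matrix.diagonal ε * H).mulVec X = X := by 
  have hε : ∀ i, X i * ((Real.sqrt v)⁻¹ • H.mulVec X) i = 1 ∨
      X i * ((Real.sqrt v)⁻¹ • H.mulVec X) i = -1 := by
    intro i
    rcases hX i with h | h <;> rcases hbent i with h' | h' <;> rw [h, h'] <;> norm_num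
  generalize hY : (Real.sqrt v)⁻¹ • H.mulVec X = Y at *
  refine ⟨fun i => X i * Y i, hε, ⟨?_, ?_⟩, ?_⟩
  · intro i j
    rw [Matrix.diagonal_mul]
    rcases hε i with h | h <;> rcases hH.1 i j with h' | h' <;> rw [h, h'] <;> norm_num
  · rw [Matrix.transpose_mul, Matrix.diagonal_transpose, Matrix.mul_assoc,
      ← Matrix.mul_assoc H, hH.2, Matrix.smul_mul, Matrix.one_mul, Matrix.mul_smul,
      Matrix.diagonal_mul_diagonal]
    congr 1
    rw [← Matrix.diagonal_one]
    congr 1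
    funext i
    rcases hε i with h | h <;> simp only [h] <;> norm_num
  · rw [← Matrix.mulVec_mulVec, ← Matrix.mulVec_smul, hY]
    funext i
    rw [Matrix.mulVec_diagonal]
    rcases hbent i with h | h <;> rw [h] <;> ring
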